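/- Let λ, λ′ > 0 and let p, p′ : ℕ → ℝ be probability mass functions with p(0) = p′(0) = 0 such that p′(i) > 0 whenever p(i) > 0 and KL(p, p′) is finite. Let q and q′ be the compound Poisson distributions of (λ, p) and (λ′, p′), i.e., q(i) = ∑_{n=0}^∞ e^{−λ} (λⁿ/n!) p^{∗n}(i) and similarly for q′. Then KL(q, q′) ≤ λ · KL(p, p′) + λ′ − λ + λ log(λ/λ′). -/

import Mathlib

open MeasureTheory
open scoped BigOperators Classical

noncomputable section

/-- Discrete convolution of two sequences. -/
def conv (a b : ℕ → ℝ) : ℕ → ℝ := fun i => ∑ k ∈ Finset.range (i + 1), a k * b (i - k)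

/-- The sequence δ₀ with δ₀(0) = 1 and δ₀(k) = 0 for k ≥ 1. -/
def delta0 : ℕ → ℝ := fun i => if i = 0 then 1 else 0

/-- Convolution powers: a^{∗0} = δ₀, a^{∗(n+1)} = a^{∗n} ∗ a. -/
def convPow (a : ℕ → ℝ) : ℕ → ℕ → ℝ
  | 0 => delta0
  | n + 1 => conv (convPow a n) a

/-- The ℓ¹ norm of a sequence. -/
def l1 (a : ℕ → ℝ) : ℝ := ∑' i, |a i|

/-- exp(a) = ∑_{j=0}^∞ a^{∗j}/j!, defined coordinatewise. -/
def expSeq (a : ℕ → ℝ) : ℕ → ℝ := fun i => ∑' j, convPow a j i / (Nat.factorial j : ℝ)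

/-- p is a probability mass function on ℕ₀. -/
def IsPMF (p : ℕ → ℝ) : Prop := (∀ i, 0 ≤ p i) ∧ ∑' i, p i = 1

/-- Kullback–Leibler divergence. -/
def KL (u v : ℕ → ℝ) : ℝ := ∑' i, u i * Real.log (u i / v i)

/-- The V divergence. -/
def Vd (u v : ℕ → ℝ) : ℝ := ∑' i, u i * (Real.log (u i / v i)) ^ 2

/-- Squared Hellinger distance. -/
def hellSq (u v : ℕ → ℝ) : ℝ := ∑' i, (Real.sqrt (u i) - Real.sqrt (v i)) ^ 2

/-- Hellinger distance. -/
def hell (u v : ℕ → ℝ) : ℝ := Real.sqrt (hellSq u v)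

/-- The compound Poisson distribution of (λ, p). -/
def cpq (lam : ℝ) (p : ℕ → ℝ) : ℕ → ℝ :=
  fun i => ∑' n, Real.exp (-lam) * lam ^ n / (Nat.factorial n : ℝ) * convPow p n i

/-- The nonnegative Kullback–Leibler integrand `a log (a / b) - a + b`. -/
def klTerm (a b : ℝ) : ℝ := a * Real.log (a / b) - a + b

lemma mul_log_div_ge_tangent {a b A B : ℝ} (ha : 0 ≤ a) (hb : 0 ≤ b) (hab : b = 0 → a = 0)
    (hA : 0 < A) (hB : 0 < B) :
    a * Real.log (A / B) + a - b * (A / B) ≤ a * Real.log (a / b) := by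
  rcases ha.eq_or_lt with rfl | ha
  · have : 0 ≤ b * (A / B) := by positivity
    simp only [zero_mul]
    linarith
  · have hb : 0 < b := hb.lt_of_ne' fun h => ha.ne' (hab h)
    have h := Real.one_sub_inv_le_log_of_pos (x := (a / b) / (A / B)) (by positivity)
    rw [Real.log_div (by positivity) (by positivity)] at h
    have h' := mul_le_mul_of_nonneg_left h ha.le
    have e : a * (1 - ((a / b) / (A / B))⁻¹) = a - b * (A / B) := by
      field_simp
    rw [e] at h'
    linarith

lemma klTerm_nonneg {a b : ℝ} (ha : 0 ≤ a) (hb : 0 ≤ b) (hab : b = 0 → a = 0) :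
    0 ≤ klTerm a b := by
  have h := mul_log_div_ge_tangent ha hb hab one_pos one_pos
  simp only [klTerm]
  simp at h
  linarith

/-- The log-sum inequality. -/
lemma klTerm_sum_le {ι : Type*} (s : Finset ι) (f g : ι → ℝ) (hf : ∀ i, 0 ≤ f i)
    (hg : ∀ i, 0 ≤ g i) (hfg : ∀ i, g i = 0 → f i = 0) :
    klTerm (∑ i ∈ s, f i) (∑ i ∈ s, g i) ≤ ∑ i ∈ s, klTerm (f i) (g i) := by
  have hsum : ∑ i ∈ s, klTerm (f i) (g i)
      = ∑ i ∈ s, f i * Real.log (f i / g i) - ∑ i ∈ s, f i + ∑ i ∈ s, g i := by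
    simp only [klTerm, Finset.sum_add_distrib, Finset.sum_sub_distrib]
  rw [hsum, klTerm]
  gcongr
  rcases (Finset.sum_nonneg fun i (_ : i ∈ s) => hf i).eq_or_lt with hA | hA
  · have hz := (Finset.sum_eq_zero_iff_of_nonneg fun i _ => hf i).1 hA.symm
    rw [← hA, zero_mul]
    exact (Finset.sum_eq_zero fun i hi => by rw [hz i hi, zero_mul]).ge
  · have hB : 0 < ∑ i ∈ s, g i := by
      refine (Finset.sum_nonneg fun i _ => hg i).lt_of_ne' fun h => hA.ne' ?_
      have hz := (Finset.sum_eq_zero_iff_of_nonneg fun i _ => hg i).1 h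
      exact Finset.sum_eq_zero fun i hi => hfg i (hz i hi)
    have h := Finset.sum_le_sum fun i (_ : i ∈ s) =>
      mul_log_div_ge_tangent (hf i) (hg i) (hfg i) hA hB
    rw [Finset.sum_sub_distrib, Finset.sum_add_distrib, ← Finset.sum_mul, ← Finset.sum_mul,
      mul_div_cancel₀ _ hB.ne'] at h
    linarith

lemma klTerm_mul {x x' y y' : ℝ} (hx : x' = 0 → x = 0) (hy : y' = 0 → y = 0) :
    klTerm (x * y) (x' * y') = klTerm x x' * y + x * klTerm y y' + (x - x') * (y - y') := by
  by_cases hx0 : x = 0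
  · subst hx0
    simp only [klTerm, zero_mul]
    ring
  by_cases hy0 : y = 0
  · subst hy0
    simp only [klTerm, zero_mul, mul_zero]
    ring
  have hx' : x' ≠ 0 := fun h => hx0 (hx h)
  have hy' : y' ≠ 0 := fun h => hy0 (hy h)
  simp only [klTerm]
  rw [mul_div_mul_comm, Real.log_mul (div_ne_zero hx0 hx') (div_ne_zero hy0 hy')]
  ring

lemma IsPMF.hasSum {p : ℕ → ℝ} (hp : IsPMF p) : HasSum p 1 := by
  have hs : Summable p := by
    by_contra h
    have h1 := hp.2
    rw [tsum_eq_zero_of_not_summable h] at h1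
    exact zero_ne_one h1
  exact hp.2 ▸ hs.hasSum

lemma hasSum_conv {a b : ℕ → ℝ} {s t : ℝ} (ha : HasSum a s) (hb : HasSum b t) :
    HasSum (conv a b) (s * t) := by
  have h := hasSum_sum_range_mul_of_summable_norm ha.summable.norm hb.summable.norm
  rwa [ha.tsum_eq, hb.tsum_eq] at h

lemma convPow_succ_apply (a : ℕ → ℝ) (n i : ℕ) :
    convPow a (n + 1) i = ∑ k ∈ Finset.range (i + 1), convPow a n k * a (i - k) := rfl

lemma isPMF_convPow {p : ℕ → ℝ} (hp : IsPMF p) (n : ℕ) : IsPMF (convPow p n) := by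
  induction n with
  | zero =>
    refine ⟨fun i => ?_, ?_⟩
    · simp only [convPow, delta0]
      split_ifs <;> norm_num
    · simp only [convPow, delta0]
      exact tsum_ite_eq 0 _
  | succ n ih =>
    refine ⟨fun i => ?_, ?_⟩
    · rw [convPow_succ_apply]
      exact Finset.sum_nonneg fun k _ => mul_nonneg (ih.1 _) (hp.1 _)
    have h := (hasSum_conv ih.hasSum hp.hasSum).tsum_eq
    rwa [one_mul] at h

lemma convPow_eq_zero_of_lt {p : ℕ → ℝ} (h0 : p 0 = 0) {n i : ℕ} (h : i < n) :
    convPow p n i = 0 := by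
  induction n generalizing i with
  | zero => omega
  | succ n ih =>
    rw [convPow_succ_apply]
    refine Finset.sum_eq_zero fun k hk => ?_
    rw [Finset.mem_range] at hk
    rcases lt_or_ge k n with hkn | hkn
    · rw [ih hkn, zero_mul]
    · rw [show i - k = 0 by omega, h0, mul_zero]

lemma convPow_absolutelyContinuous {p p' : ℕ → ℝ} (hp' : IsPMF p')
    (habs : ∀ i, p' i = 0 → p i = 0) (n i : ℕ) (h : convPow p' n i = 0) :
    convPow p n i = 0 := by
  induction n generalizing i with
  | zero => exact h
  | succ n ih =>
    rw [convPow_succ_apply] at h ⊢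
    have hz := (Finset.sum_eq_zero_iff_of_nonneg fun k _ =>
      mul_nonneg ((isPMF_convPow hp' n).1 k) (hp'.1 (i - k))).1 h
    refine Finset.sum_eq_zero fun k hk => ?_
    rcases mul_eq_zero.1 (hz k hk) with h | h
    · rw [ih k h, zero_mul]
    · rw [habs _ h, mul_zero]

lemma hasSum_klTerm_convPow {p p' : ℕ → ℝ} (hp : IsPMF p) (hp' : IsPMF p')
    (habs : ∀ i, p' i = 0 → p i = 0) {K : ℝ} (hK : HasSum (fun i => klTerm (p i) (p' i)) K)
    (n : ℕ) : ∃ c ≤ n * K, HasSum (fun i => klTerm (convPow p n i) (convPow p' n i)) c := by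
  induction n with
  | zero =>
    refine ⟨0, by simp, ?_⟩
    convert! hasSum_zero using 2 with i
    simp only [convPow, delta0]
    split_ifs <;> simp [klTerm]
  | succ n ih =>
    obtain ⟨c, hc, hs⟩ := ih
    have hP := isPMF_convPow hp n
    have hP' := isPMF_convPow hp' n
    have habsn := convPow_absolutelyContinuous hp' habs n
    have hub := ((hasSum_conv hs hp.hasSum).add (hasSum_conv hP.hasSum hK)).add
      (hasSum_conv (hP.hasSum.sub hP'.hasSum) (hp.hasSum.sub hp'.hasSum))
    have hle : ∀ i, klTerm (convPow p (n + 1) i) (convPow p' (n + 1) i) ≤ _ := fun i =>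
      (klTerm_sum_le (Finset.range (i + 1)) (fun k => convPow p n k * p (i - k))
        (fun k => convPow p' n k * p' (i - k)) (fun k => mul_nonneg (hP.1 _) (hp.1 _))
        (fun k => mul_nonneg (hP'.1 _) (hp'.1 _)) fun k hk => by
          rcases mul_eq_zero.1 hk with h | h
          · rw [habsn k h, zero_mul]
          · rw [habs _ h, mul_zero]).trans_eq <| by
        simp only [klTerm_mul (habsn _) (habs _), Finset.sum_add_distrib]
        rfl
    have hnn : ∀ i, 0 ≤ klTerm (convPow p (n + 1) i) (convPow p' (n + 1) i) := fun i =>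
      klTerm_nonneg ((isPMF_convPow hp _).1 i) ((isPMF_convPow hp' _).1 i)
        (convPow_absolutelyContinuous hp' habs _ i)
    have hsum := Summable.of_nonneg_of_le hnn hle hub.summable
    refine ⟨_, ?_, hsum.hasSum⟩
    refine (hasSum_le hle hsum.hasSum hub).trans ?_
    push_cast
    linarith

/-- The Poisson weight `e^{-r} rⁿ / n!`. -/
def poissonWeight (r : ℝ) (n : ℕ) : ℝ := Real.exp (-r) * r ^ n / (Nat.factorial n : ℝ)

lemma poissonWeight_pos {r : ℝ} (hr : 0 < r) (n : ℕ) : 0 < poissonWeight r n := by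
  unfold poissonWeight
  positivity

lemma hasSum_poissonWeight {r : ℝ} (hr : 0 < r) : HasSum (poissonWeight r) 1 :=
  ProbabilityTheory.hasSum_one_poissonMeasure ⟨r, hr.le⟩

lemma hasSum_mul_poissonWeight {r : ℝ} (hr : 0 < r) :
    HasSum (fun n : ℕ => n * poissonWeight r n) r := by
  rw [← hasSum_nat_add_iff' 1]
  convert! (hasSum_poissonWeight hr).mul_left r using 1
  · ext n
    simp only [poissonWeight, Nat.factorial_succ]
    push_cast
    field_simp
    ring
  · simp

lemma klTerm_poissonWeight {r r' : ℝ} (hr : 0 < r) (hr' : 0 < r') (n : ℕ) :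
    klTerm (poissonWeight r n) (poissonWeight r' n)
      = (r' - r) * poissonWeight r n + n * poissonWeight r n * Real.log (r / r')
        - poissonWeight r n + poissonWeight r' n := by
  have h : poissonWeight r n / poissonWeight r' n = Real.exp (r' - r) * (r / r') ^ n := by
    rw [sub_eq_add_neg, Real.exp_add, ← neg_neg r', Real.exp_neg (-r'), neg_neg]
    simp only [poissonWeight, div_pow]
    field_simp
  rw [klTerm, h, Real.log_mul (by positivity) (by positivity), Real.log_exp, Real.log_pow]
  ring

lemma hasSum_klTerm_poissonWeight {r r' : ℝ} (hr : 0 < r) (hr' : 0 < r') :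
    HasSum (fun n => klTerm (poissonWeight r n) (poissonWeight r' n))
      (r' - r + r * Real.log (r / r')) := by
  have h := ((((hasSum_poissonWeight hr).mul_left (r' - r)).add
    ((hasSum_mul_poissonWeight hr).mul_right (Real.log (r / r')))).sub
    (hasSum_poissonWeight hr)).add (hasSum_poissonWeight hr')
  convert! h using 1
  · exact funext (klTerm_poissonWeight hr hr')
  · ring

lemma cpq_eq_sum {p : ℕ → ℝ} (h0 : p 0 = 0) (r : ℝ) {i N : ℕ} (h : i < N) :
    cpq r p i = ∑ n ∈ Finset.range N, poissonWeight r n * convPow p n i := by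
  refine tsum_eq_sum fun n hn => ?_
  rw [Finset.mem_range, not_lt] at hn
  rw [convPow_eq_zero_of_lt h0 (h.trans_le hn), mul_zero]

lemma hasSum_cpq {p : ℕ → ℝ} (hp : IsPMF p) {r : ℝ} (hr : 0 < r) : HasSum (cpq r p) 1 := by
  have hrow : ∀ n, HasSum (fun i => poissonWeight r n * convPow p n i) (poissonWeight r n) :=
    fun n => by simpa using (isPMF_convPow hp n).hasSum.mul_left (poissonWeight r n)
  have hs : Summable fun x : ℕ × ℕ => poissonWeight r x.1 * convPow p x.1 x.2 := by
    rw [summable_prod_of_nonneg fun x =>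
      mul_nonneg (poissonWeight_pos hr _).le ((isPMF_convPow hp _).1 _)]
    refine ⟨fun n => (hrow n).summable, ?_⟩
    simpa only [fun n => (hrow n).tsum_eq] using (hasSum_poissonWeight hr).summable
  have htot := hs.hasSum.prod_fiberwise hrow
  have hone := htot.unique (hasSum_poissonWeight hr)
  have hswap := (Equiv.prodComm ℕ ℕ).hasSum_iff.2 hs.hasSum
  rw [hone] at hswap
  exact hswap.prod_fiberwise fun i => (hs.prod_symm.prod_factor i).hasSum

/-- KL(q, q′) ≤ λ·KL(p, p′) + λ′ − λ + λ log(λ/λ′). -/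
theorem stmt16 (lam lam' : ℝ) (hl : 0 < lam) (hl' : 0 < lam')
    (p p' : ℕ → ℝ) (hp : IsPMF p) (hp' : IsPMF p') (h0 : p 0 = 0) (h0' : p' 0 = 0)
    (habs : ∀ i, 0 < p i → 0 < p' i)
    (hKL : Summable fun i => p i * Real.log (p i / p' i)) :
    KL (cpq lam p) (cpq lam' p') ≤
      lam * KL p p' + lam' - lam + lam * Real.log (lam / lam') := by
  have habs0 : ∀ i, p' i = 0 → p i = 0 := fun i h => by
    by_contra hne
    exact (habs i ((hp.1 i).lt_of_ne' hne)).ne' h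
  have hK : HasSum (fun i => klTerm (p i) (p' i)) (KL p p') := by
    simpa [klTerm, KL] using (hKL.hasSum.sub hp.hasSum).add hp'.hasSum
  set w := poissonWeight lam
  set w' := poissonWeight lam'
  have hw : ∀ n, 0 < w n := poissonWeight_pos hl
  have hw' : ∀ n, 0 < w' n := poissonWeight_pos hl'
  have hP := fun n => isPMF_convPow hp n
  have hP' := fun n => isPMF_convPow hp' n
  have habsn := convPow_absolutelyContinuous hp' habs0
  have habsw : ∀ n i, w' n * convPow p' n i = 0 → w n * convPow p n i = 0 := fun n i h => by
    rw [habsn n i ((mul_eq_zero.1 h).resolve_left (hw' n).ne'), mul_zero]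
  have hnn : ∀ n i, 0 ≤ klTerm (w n * convPow p n i) (w' n * convPow p' n i) := fun n i =>
    klTerm_nonneg (mul_nonneg (hw n).le ((hP n).1 i)) (mul_nonneg (hw' n).le ((hP' n).1 i))
      (habsw n i)
  have hrow : ∀ n, ∃ c ≤ n * w n * KL p p' + klTerm (w n) (w' n),
      HasSum (fun i => klTerm (w n * convPow p n i) (w' n * convPow p' n i)) c := by
    intro n
    obtain ⟨c, hc, hs⟩ := hasSum_klTerm_convPow hp hp' habs0 hK n
    refine ⟨klTerm (w n) (w' n) * 1 + w n * c + (w n - w' n) * (1 - 1), ?_, ?_⟩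
    · have := mul_le_mul_of_nonneg_left hc (hw n).le
      linarith
    · have hmul := funext fun i =>
        klTerm_mul (x := w n) (fun h => absurd h (hw' n).ne') (habsn n i)
      rw [hmul]
      exact (((hP n).hasSum.mul_left _).add (hs.mul_left _)).add
        (((hP n).hasSum.sub (hP' n).hasSum).mul_left _)
  have htotal : HasSum (fun n => n * w n * KL p p' + klTerm (w n) (w' n))
      (lam * KL p p' + (lam' - lam + lam * Real.log (lam / lam'))) :=
    ((hasSum_mul_poissonWeight hl).mul_right _).add (hasSum_klTerm_poissonWeight hl hl')
  have hrow_nonneg : ∀ n : ℕ, 0 ≤ n * w n * KL p p' + klTerm (w n) (w' n) := fun n => by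
    obtain ⟨c, hc, hs⟩ := hrow n
    exact (hs.nonneg (hnn n)).trans hc
  have hpart : ∀ N, ∑ i ∈ Finset.range N, klTerm (cpq lam p i) (cpq lam' p' i)
      ≤ lam * KL p p' + (lam' - lam + lam * Real.log (lam / lam')) := fun N => by
    calc ∑ i ∈ Finset.range N, klTerm (cpq lam p i) (cpq lam' p' i)
        ≤ ∑ i ∈ Finset.range N, ∑ n ∈ Finset.range N,
            klTerm (w n * convPow p n i) (w' n * convPow p' n i) := by
          refine Finset.sum_le_sum fun i hi => ?_
          rw [Finset.mem_range] at hi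
          rw [cpq_eq_sum h0 lam hi, cpq_eq_sum h0' lam' hi]
          exact klTerm_sum_le _ _ _ (fun n => mul_nonneg (hw n).le ((hP n).1 i))
            (fun n => mul_nonneg (hw' n).le ((hP' n).1 i)) fun n => habsw n i
      _ = ∑ n ∈ Finset.range N, ∑ i ∈ Finset.range N,
            klTerm (w n * convPow p n i) (w' n * convPow p' n i) := Finset.sum_comm
      _ ≤ ∑ n ∈ Finset.range N, (n * w n * KL p p' + klTerm (w n) (w' n)) := by
          refine Finset.sum_le_sum fun n _ => ?_
          obtain ⟨c, hc, hs⟩ := hrow n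
          exact (sum_le_hasSum _ (fun i _ => hnn n i) hs).trans hc
      _ ≤ _ := sum_le_hasSum _ (fun n _ => hrow_nonneg n) htotal
  have hq_nonneg : ∀ i, 0 ≤ klTerm (cpq lam p i) (cpq lam' p' i) := fun i => by
    have hi := Nat.lt_succ_self i
    rw [cpq_eq_sum h0 lam hi, cpq_eq_sum h0' lam' hi]
    refine klTerm_nonneg (Finset.sum_nonneg fun n _ => mul_nonneg (hw n).le ((hP n).1 i))
      (Finset.sum_nonneg fun n _ => mul_nonneg (hw' n).le ((hP' n).1 i)) fun h => ?_
    have hz := (Finset.sum_eq_zero_iff_of_nonneg fun n _ =>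
      mul_nonneg (hw' n).le ((hP' n).1 i)).1 h
    exact Finset.sum_eq_zero fun n hn => habsw n i (hz n hn)
  have hkl := ((summable_of_sum_range_le hq_nonneg hpart).hasSum.add (hasSum_cpq hp hl)).sub
    (hasSum_cpq hp' hl')
  have hKLq : KL (cpq lam p) (cpq lam' p')
      = ∑' i, klTerm (cpq lam p i) (cpq lam' p' i) := by
    rw [add_sub_cancel_right] at hkl
    rw [← hkl.tsum_eq, KL]
    exact tsum_congr fun i => by rw [klTerm]; ring
  rw [hKLq]
  linarith [Real.tsum_le_of_sum_range_le hq_nonneg hpart]
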